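/- arXiv:1203.2813 — 2 statements merged into one kernel-verified Lean document; each statement's English description precedes it below -/
import Mathlib

section
/- Let K be an infinite compact subset of ℝ^d. Then the set of measures μ ∈ P(K) such that for every q > 1 the lower L^q-dimension of μ equals 0 is residual in P(K) (it contains a dense G_δ set). -/
open MeasureTheory Filter Metric Set Topology

noncomputable section

/-- `ℝ^d` with the Euclidean metric. -/
abbrev Euc (d : ℕ) : Type := EuclideanSpace ℝ (Fin d)

/-- The largest number of pairwise disjoint balls of radius `r` with centers in `E`. -/
noncomputable def packingNumber {X : Type*} [MetricSpace X] (E : Set X) (r : ℝ) : ℕ :=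
  sSup {n : ℕ | ∃ c : Fin n → X, (∀ i, c i ∈ E) ∧
    Pairwise fun i j => Disjoint (ball (c i) r) (ball (c j) r)}

/-- The smallest number of balls of radius `r` needed to cover `E`. -/
noncomputable def coveringNumber {X : Type*} [MetricSpace X] (E : Set X) (r : ℝ) : ℕ :=
  sInf {n : ℕ | ∃ c : Fin n → X, E ⊆ ⋃ i, ball (c i) r}

/-- Upper box (Minkowski) dimension. -/
noncomputable def upperBoxDim {X : Type*} [MetricSpace X] (E : Set X) : EReal :=
  limsup (fun r : ℝ => ((Real.log (coveringNumber E r : ℝ) / (-Real.log r) : ℝ) : EReal))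
    (𝓝[>] (0:ℝ))

/-- Lower box (Minkowski) dimension. -/
noncomputable def lowerBoxDim {X : Type*} [MetricSpace X] (E : Set X) : EReal :=
  liminf (fun r : ℝ => ((Real.log (coveringNumber E r : ℝ) / (-Real.log r) : ℝ) : EReal))
    (𝓝[>] (0:ℝ))

/-- Packing dimension, defined as the modified upper box dimension. -/
noncomputable def packingDim {X : Type*} [MetricSpace X] (E : Set X) : EReal :=
  ⨅ (F : ℕ → Set X) (_ : E ⊆ ⋃ n, F n), ⨆ n, upperBoxDim (F n)

/-- The local uniform upper box dimension. -/
noncomputable def locUnifUpperBoxDim {X : Type*} [MetricSpace X] (K : Set X) : EReal :=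
  ⨅ (N : ℕ) (_ : 1 ≤ N) (x : Fin N → X) (_ : ∀ i, x i ∈ K) (r₀ : ℝ) (_ : 0 < r₀),
    limsup (fun r : ℝ =>
      ((⨅ i : Fin N, Real.log (packingNumber (K ∩ ball (x i) r₀) r : ℝ) / (-Real.log r) : ℝ)
        : EReal)) (𝓝[>] (0:ℝ))

/-- The convex upper box dimension. -/
noncomputable def convUpperBoxDim {X : Type*} [MetricSpace X] (K : Set X) : EReal :=
  ⨅ (N : ℕ) (_ : 1 ≤ N) (x : Fin N → X) (_ : ∀ i, x i ∈ K) (ρ : ℝ) (_ : 0 < ρ)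
    (p : Fin N → ℝ) (_ : ∀ i, 0 < p i) (_ : ∑ i, p i = 1),
    limsup (fun r : ℝ =>
      (((∑ i, p i * Real.log (packingNumber (K ∩ ball (x i) ρ) r : ℝ)) / (-Real.log r) : ℝ)
        : EReal)) (𝓝[>] (0:ℝ))

/-- The maximal convex upper box dimension. -/
noncomputable def convUpperBoxDimMax {X : Type*} [MetricSpace X] (K : Set X) : EReal :=
  ⨆ (y : X) (_ : y ∈ K) (ρ : ℝ) (_ : 0 < ρ), convUpperBoxDim (K ∩ ball y ρ)

/-- `I_μ(r,q)`, with the logarithmic convention at `q = 1`. -/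
noncomputable def Iq {X : Type*} [MetricSpace X] [MeasurableSpace X]
    (μ : Measure X) (r q : ℝ) : ℝ :=
  if q = 1 then ∫ x, Real.log ((μ (ball x r)).toReal) ∂μ
  else ∫ x, ((μ (ball x r)).toReal) ^ (q - 1) ∂μ

/-- The quantity whose `liminf`/`limsup` as `r → 0⁺` gives the lower/upper `L^q`-dimensions. -/
noncomputable def Dq {X : Type*} [MetricSpace X] [MeasurableSpace X]
    (μ : Measure X) (r q : ℝ) : ℝ :=
  if q = 1 then Iq μ r 1 / Real.log r
  else (1 / (q - 1)) * (Real.log (Iq μ r q) / Real.log r)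

/-- The upper `L^q`-dimension of a measure. -/
noncomputable def upperDim {X : Type*} [MetricSpace X] [MeasurableSpace X]
    (μ : Measure X) (q : ℝ) : EReal :=
  limsup (fun r : ℝ => ((Dq μ r q : ℝ) : EReal)) (𝓝[>] (0:ℝ))

/-- The lower `L^q`-dimension of a measure. -/
noncomputable def lowerDim {X : Type*} [MetricSpace X] [MeasurableSpace X]
    (μ : Measure X) (q : ℝ) : EReal :=
  liminf (fun r : ℝ => ((Dq μ r q : ℝ) : EReal)) (𝓝[>] (0:ℝ))

/-- The (topological) support of a measure. -/
noncomputable def msupport {X : Type*} [MetricSpace X] [MeasurableSpace X]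
    (μ : Measure X) : Set X :=
  {x | ∀ r > (0:ℝ), 0 < μ (ball x r)}

/-- The upper `L^∞`-dimension of a measure. -/
noncomputable def upperDimInfty {X : Type*} [MetricSpace X] [MeasurableSpace X]
    (μ : Measure X) : EReal :=
  limsup (fun r : ℝ =>
    ((Real.log (⨆ x ∈ msupport μ, (μ (ball x r)).toReal) / Real.log r : ℝ) : EReal))
    (𝓝[>] (0:ℝ))

/-- The lower `L^∞`-dimension of a measure. -/
noncomputable def lowerDimInfty {X : Type*} [MetricSpace X] [MeasurableSpace X]
    (μ : Measure X) : EReal :=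
  liminf (fun r : ℝ =>
    ((Real.log (⨆ x ∈ msupport μ, (μ (ball x r)).toReal) / Real.log r : ℝ) : EReal))
    (𝓝[>] (0:ℝ))

/-- The upper `L^{-∞}`-dimension of a measure. -/
noncomputable def upperDimNegInfty {X : Type*} [MetricSpace X] [MeasurableSpace X]
    (μ : Measure X) : EReal :=
  limsup (fun r : ℝ =>
    ((Real.log (⨅ x ∈ msupport μ, (μ (ball x r)).toReal) / Real.log r : ℝ) : EReal))
    (𝓝[>] (0:ℝ))

/-- The lower `L^{-∞}`-dimension of a measure. -/
noncomputable def lowerDimNegInfty {X : Type*} [MetricSpace X] [MeasurableSpace X]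
    (μ : Measure X) : EReal :=
  liminf (fun r : ℝ =>
    ((Real.log (⨅ x ∈ msupport μ, (μ (ball x r)).toReal) / Real.log r : ℝ) : EReal))
    (𝓝[>] (0:ℝ))

/-- The half-closed dyadic cube of side `2^{-n}` indexed by `k`. -/
noncomputable def dyadicCube (d n : ℕ) (k : Fin d → ℤ) : Set (Euc d) :=
  {x | ∀ j, (k j : ℝ) / 2 ^ n ≤ x j ∧ x j < ((k j : ℝ) + 1) / 2 ^ n}

/-- `K_n`: the union of the half-closed dyadic cubes of side `2^{-n}` meeting `K`. -/
noncomputable def dyadicHull (d : ℕ) (K : Set (Euc d)) (n : ℕ) : Set (Euc d) :=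
  ⋃ (k : Fin d → ℤ) (_ : (dyadicCube d n k ∩ K).Nonempty), dyadicCube d n k

/-- The number of connected components of a set. -/
noncomputable def numComponents {X : Type*} [TopologicalSpace X] (S : Set X) : ℕ :=
  Nat.card {C : Set X // ∃ x ∈ S, C = connectedComponentIn S x}

/-- The box separation index `bsi(K)`. -/
noncomputable def bsi (d : ℕ) (K : Set (Euc d)) : ℝ :=
  liminf (fun n : ℕ =>
    Real.log (numComponents (dyadicHull d K n) : ℝ) / (n * Real.log 2)) atTop

/-- The Fortet–Mourier distance between two measures. -/
noncomputable def FMdist {X : Type*} [MetricSpace X] [MeasurableSpace X]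
    (μ ν : Measure X) : ℝ :=
  ⨆ f : {f : X → ℝ // LipschitzWith 1 f ∧ ∀ x, |f x| ≤ 1},
    |∫ x, f.1 x ∂μ - ∫ x, f.1 x ∂ν|


section HeavyBalls

variable {X : Type*} [MetricSpace X] [MeasurableSpace X]

/-- The `q`-th power of the mass of a ball of radius `r / 2` bounds `I_μ(r,q)` from below. -/
lemma rpow_measureReal_ball_le_Iq [BorelSpace X] [SecondCountableTopology X] (μ : Measure X)
    [IsProbabilityMeasure μ] {q : ℝ} (hq : 1 < q) (x : X) (r : ℝ) :
    μ.real (ball x (r / 2)) ^ q ≤ Iq μ r q := by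
  set f : X → ℝ := fun y => μ.real (ball y r) ^ (q - 1) with hf
  have hf0 : ∀ y, 0 ≤ f y := fun y => by positivity
  have hmeas : Measurable f := by
    have hs : MeasurableSet {p : X × X | dist p.2 p.1 < r} :=
      (isOpen_lt (by fun_prop) continuous_const).measurableSet
    exact (measurable_measure_prodMk_left (ν := μ) hs).ennreal_toReal.pow_const _
  have hint : Integrable f μ := by
    refine Integrable.of_bound hmeas.aestronglyMeasurable 1 (Eventually.of_forall fun y => ?_)
    rw [Real.norm_of_nonneg (hf0 y)]
    exact Real.rpow_le_one measureReal_nonneg measureReal_le_one (by linarith)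
  have hle : ∀ y ∈ ball x (r / 2), μ.real (ball x (r / 2)) ^ (q - 1) ≤ f y := by
    intro y hy
    refine Real.rpow_le_rpow measureReal_nonneg (measureReal_mono ?_) (by linarith)
    refine ball_subset_ball' ?_
    rw [mem_ball, dist_comm] at hy
    linarith
  calc μ.real (ball x (r / 2)) ^ q
      = μ.real (ball x (r / 2)) ^ (q - 1) * μ.real (ball x (r / 2)) := by
        rcases measureReal_nonneg (μ := μ) (s := ball x (r / 2)) |>.eq_or_lt with h | h
        · rw [← h, Real.zero_rpow (by linarith), mul_zero]
        · rw [← Real.rpow_add_one h.ne']; ring_nf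
    _ ≤ ∫ y in ball x (r / 2), f y ∂μ :=
        setIntegral_ge_of_const_le_real measurableSet_ball (measure_ne_top _ _) hle
          hint.integrableOn
    _ ≤ ∫ y, f y ∂μ := setIntegral_le_integral hint (Eventually.of_forall hf0)
    _ = Iq μ r q := by rw [Iq, if_neg hq.ne']; rfl

lemma Iq_le_one (μ : Measure X) [IsProbabilityMeasure μ] {q : ℝ} (hq : 1 < q) (r : ℝ) :
    Iq μ r q ≤ 1 := by
  rw [Iq, if_neg hq.ne']
  have h := norm_integral_le_of_norm_le_const (μ := μ) (C := 1)
    (f := fun y => (μ (ball y r)).toReal ^ (q - 1)) (Eventually.of_forall fun y => by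
      rw [Real.norm_of_nonneg (by positivity)]
      exact Real.rpow_le_one measureReal_nonneg measureReal_le_one (by linarith))
  simpa using (le_abs_self _).trans h

lemma Iq_nonneg (μ : Measure X) {q : ℝ} (hq : 1 < q) (r : ℝ) : 0 ≤ Iq μ r q := by
  rw [Iq, if_neg hq.ne']
  exact integral_nonneg fun y => by positivity

lemma Dq_nonneg (μ : Measure X) [IsProbabilityMeasure μ] {q r : ℝ} (hq : 1 < q) (hr0 : 0 < r)
    (hr1 : r < 1) : 0 ≤ Dq μ r q := by
  rw [Dq, if_neg hq.ne']
  exact mul_nonneg (one_div_nonneg.2 (by linarith)) (div_nonneg_of_nonpos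
    (Real.log_nonpos (Iq_nonneg μ hq r) (Iq_le_one μ hq r)) (Real.log_neg hr0 hr1).le)

/-- If some ball of radius `r / 2` has mass more than `r ^ s`, then the quotient defining the
`L^q`-dimension is at most `s * q / (q - 1)` at scale `r`. -/
lemma Dq_le_of_rpow_lt [BorelSpace X] [SecondCountableTopology X] (μ : Measure X)
    [IsProbabilityMeasure μ] {q r s : ℝ} (hq : 1 < q) (hr0 : 0 < r) (hr1 : r < 1) {x : X}
    (h : r ^ s < μ.real (ball x (r / 2))) : Dq μ r q ≤ s * (q / (q - 1)) := by
  have hI : r ^ (s * q) ≤ Iq μ r q := by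
    rw [Real.rpow_mul hr0.le]
    exact (Real.rpow_le_rpow (by positivity) h.le (by linarith)).trans
      (rpow_measureReal_ball_le_Iq μ hq x r)
  have hlog : s * q * Real.log r ≤ Real.log (Iq μ r q) := by
    rw [← Real.log_rpow hr0]
    exact Real.log_le_log (by positivity) hI
  have hdiv : Real.log (Iq μ r q) / Real.log r ≤ s * q :=
    (div_le_iff_of_neg (Real.log_neg hr0 hr1)).2 hlog
  rw [Dq, if_neg hq.ne']
  calc 1 / (q - 1) * (Real.log (Iq μ r q) / Real.log r) ≤ 1 / (q - 1) * (s * q) :=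
        mul_le_mul_of_nonneg_left hdiv (one_div_nonneg.2 (by linarith))
    _ = s * (q / (q - 1)) := by ring

/-- The probability measures giving mass more than `r ^ ε` to some ball of radius `r / 2`, for
some `r < ε`. -/
def heavyBallMeasures (X : Type*) [MetricSpace X] [MeasurableSpace X] (ε : ℝ) :
    Set (ProbabilityMeasure X) :=
  {μ | ∃ r ∈ Ioo 0 ε, ∃ x, ENNReal.ofReal (r ^ ε) < (μ : Measure X) (ball x (r / 2))}

lemma isOpen_setOf_lt_measure [OpensMeasurableSpace X] {U : Set X} (hU : IsOpen U)
    (c : ENNReal) : IsOpen {μ : ProbabilityMeasure X | c < (μ : Measure X) U} :=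
  isOpen_iff_mem_nhds.2 fun _ hμ => eventually_lt_of_lt_liminf
    (lt_of_lt_of_le hμ (ProbabilityMeasure.le_liminf_measure_open_of_tendsto tendsto_id hU))

lemma isOpen_heavyBallMeasures [OpensMeasurableSpace X] (ε : ℝ) :
    IsOpen (heavyBallMeasures X ε) := by
  have : heavyBallMeasures X ε = ⋃ r ∈ Ioo 0 ε, ⋃ x : X,
      {μ : ProbabilityMeasure X | ENNReal.ofReal (r ^ ε) < (μ : Measure X) (ball x (r / 2))} := by
    ext μ
    simp [heavyBallMeasures]
  rw [this]
  exact isOpen_biUnion fun r _ => isOpen_iUnion fun x => isOpen_setOf_lt_measure isOpen_ball _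

lemma mem_heavyBallMeasures_of_atom {μ : ProbabilityMeasure X} {x : X}
    (hx : (μ : Measure X) {x} ≠ 0) {ε : ℝ} (hε : 0 < ε) : μ ∈ heavyBallMeasures X ε := by
  have hlim : Tendsto (fun r : ℝ => ENNReal.ofReal (r ^ ε)) (𝓝[>] 0) (𝓝 0) := by
    have h : ContinuousAt (fun r : ℝ => ENNReal.ofReal (r ^ ε)) 0 :=
      ENNReal.continuous_ofReal.continuousAt.comp
        (Real.continuousAt_rpow_const _ _ (Or.inr hε.le))
    simpa [ContinuousAt, Real.zero_rpow hε.ne'] using h.mono_left nhdsWithin_le_nhds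
  obtain ⟨r, hlt, hr⟩ :=
    ((hlim.eventually_lt_const (pos_iff_ne_zero.2 hx)).and (Ioo_mem_nhdsGT hε)).exists
  exact ⟨r, hr, x, hlt.trans_le (measure_mono
    (singleton_subset_iff.2 (mem_ball_self (half_pos hr.1))))⟩

/-- Probability measures with an atom are dense. -/
lemma dense_setOf_exists_atom [OpensMeasurableSpace X] :
    Dense {μ : ProbabilityMeasure X | ∃ x, (μ : Measure X) {x} ≠ 0} := by
  intro μ
  obtain ⟨x⟩ := μ.nonempty
  let t : ℕ → ℝ := fun n => 1 / ((n : ℝ) + 1)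
  have ht0 : ∀ n, 0 < t n := fun n => Nat.one_div_pos_of_nat
  have ht1 : ∀ n, t n ≤ 1 := fun n => by
    simpa [t] using Nat.one_div_le_one_div (α := ℝ) (Nat.zero_le n)
  have ht : Tendsto t atTop (𝓝 0) := tendsto_one_div_add_atTop_nhds_zero_nat
  let m : ℕ → Measure X := fun n =>
    ENNReal.ofReal (1 - t n) • (μ : Measure X) + ENNReal.ofReal (t n) • Measure.dirac x
  have hm : ∀ n, IsProbabilityMeasure (m n) := fun n => ⟨by
    simp only [m, Measure.add_apply, Measure.smul_apply, smul_eq_mul, measure_univ, mul_one]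
    rw [← ENNReal.ofReal_add (by linarith [ht1 n]) (ht0 n).le]
    simp⟩
  let ν : ℕ → ProbabilityMeasure X := fun n => ⟨m n, hm n⟩
  have hν : ∀ n, (ν n : Measure X) = m n := fun n => rfl
  refine mem_closure_of_tendsto (f := ν) (b := atTop) ?_ (Eventually.of_forall fun n => ⟨x, ?_⟩)
  · rw [ProbabilityMeasure.tendsto_iff_forall_integral_tendsto]
    intro f
    have hint : ∀ n, ∫ y, f y ∂(m n) = (1 - t n) * ∫ y, f y ∂(μ : Measure X) + t n * f x := by
      intro n
      rw [integral_add_measure ((f.integrable _).smul_measure ENNReal.ofReal_ne_top)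
        ((f.integrable _).smul_measure ENNReal.ofReal_ne_top), integral_smul_measure,
        integral_smul_measure, ENNReal.toReal_ofReal (by linarith [ht1 n]),
        ENNReal.toReal_ofReal (ht0 n).le,
        integral_dirac' _ _ f.continuous.stronglyMeasurable]
      simp
    simp only [hν, hint]
    simpa using ((ht.const_sub 1).mul_const (∫ y, f y ∂(μ : Measure X))).add (ht.mul_const (f x))
  · have : ENNReal.ofReal (t n) ≤ m n {x} := by
      simp only [m, Measure.add_apply, Measure.smul_apply, smul_eq_mul]
      rw [Measure.dirac_apply' _ (measurableSet_singleton x)]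
      simp
    exact ((ENNReal.ofReal_pos.2 (ht0 n)).trans_le this).ne'

lemma lowerDim_eq_zero_of_forall_mem_heavyBallMeasures [BorelSpace X]
    [SecondCountableTopology X] {μ : ProbabilityMeasure X}
    (hμ : ∀ n : ℕ, μ ∈ heavyBallMeasures X (1 / ((n : ℝ) + 1))) {q : ℝ} (hq : 1 < q) :
    lowerDim (μ : Measure X) q = 0 := by
  refine le_antisymm ?_ (le_liminf_of_le (h := ?_))
  · refine EReal.le_of_forall_lt_iff_le.1 fun z hz => ?_
    have hz0 : 0 < z := by exact_mod_cast hz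
    refine liminf_le_of_frequently_le' ?_
    rw [(nhdsGT_basis (0 : ℝ)).frequently_iff]
    intro δ hδ
    have hlim : Tendsto (fun n : ℕ => 1 / ((n : ℝ) + 1) * (q / (q - 1))) atTop (𝓝 0) := by
      simpa using tendsto_one_div_add_atTop_nhds_zero_nat.mul_const (q / (q - 1))
    obtain ⟨n, hnz, hnδ⟩ := ((hlim.eventually_lt_const hz0).and
      ((tendsto_one_div_add_atTop_nhds_zero_nat (𝕜 := ℝ)).eventually_lt_const hδ)).exists
    obtain ⟨r, hr, x, hx⟩ := hμ n
    have hr1 : r < 1 := hr.2.trans_le (by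
      simpa using Nat.one_div_le_one_div (α := ℝ) (Nat.zero_le n))
    refine ⟨r, ⟨hr.1, hr.2.trans hnδ⟩, EReal.coe_le_coe_iff.2 ?_⟩
    refine (Dq_le_of_rpow_lt (μ : Measure X) hq hr.1 hr1 (x := x) ?_).trans hnz.le
    exact (ENNReal.ofReal_lt_iff_lt_toReal (Real.rpow_nonneg hr.1.le _) (measure_ne_top _ _)).1 hx
  · filter_upwards [Ioo_mem_nhdsGT (zero_lt_one' ℝ)] with r hr
    exact EReal.coe_nonneg.2 (Dq_nonneg _ hq hr.1 hr.2)

end HeavyBalls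

/-- A typical measure on an infinite compact `K ⊆ ℝ^d` has lower `L^q`-dimension equal to `0`,
simultaneously for all `q > 1`. -/
theorem typical_lowerDim_eq_zero_q_gt_one (d : ℕ) (K : Set (Euc d))
    (hK : IsCompact K) (hKinf : K.Infinite) :
    ∃ G : Set (ProbabilityMeasure ↥K),
      G ⊆ {μ : ProbabilityMeasure ↥K |
        ∀ q : ℝ, 1 < q → lowerDim (μ : Measure ↥K) q = (0 : EReal)} ∧
      Dense G ∧ IsGδ G := by
  refine ⟨⋂ n : ℕ, heavyBallMeasures K (1 / ((n : ℝ) + 1)), fun μ hμ q hq =>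
    lowerDim_eq_zero_of_forall_mem_heavyBallMeasures (mem_iInter.1 hμ) hq, ?_,
    IsGδ.iInter_of_isOpen fun n => isOpen_heavyBallMeasures _⟩
  refine dense_setOf_exists_atom.mono ?_
  rintro μ ⟨x, hx⟩
  exact mem_iInter.2 fun n => mem_heavyBallMeasures_of_atom hx Nat.one_div_pos_of_nat

end
end

section
/- Let K be an infinite compact subset of ℝ^d and let s denote the upper box dimension of K. Then the set of measures μ ∈ P(K) such that for every q ∈ [0,1) the upper L^q-dimension of μ equals s is residual in P(K) (it contains a dense G_δ set). -/
open MeasureTheory Filter Metric Set Topology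

noncomputable section

/-- Almost every point lies in a cell of positive measure of a given finite cover. -/
theorem ae_exists_mem_measure_ne_zero {X : Type*} [MeasurableSpace X] {μ : Measure X} {N : ℕ}
    {B : Fin N → Set X} (hcov : ∀ x, ∃ i, x ∈ B i) :
    ∀ᵐ x ∂μ, ∃ i, x ∈ B i ∧ μ (B i) ≠ 0 := by
  have h : ∀ᵐ x ∂μ, ∀ i, μ (B i) = 0 → x ∉ B i := by
    rw [ae_all_iff]
    intro i
    by_cases h0 : μ (B i) = 0
    · filter_upwards [measure_eq_zero_iff_ae_notMem.1 h0] with x hx _ using hx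
    · exact Eventually.of_forall fun x h => absurd h h0
  filter_upwards [h] with x hx
  obtain ⟨i, hi⟩ := hcov x
  exact ⟨i, hi, fun h0 => hx i h0 hi⟩

section BallPowers

variable {X : Type*} [MetricSpace X] [MeasurableSpace X]
  {μ : Measure X} [IsProbabilityMeasure μ] {r : ℝ} {N : ℕ} {B : Fin N → Set X}

theorem ae_measureReal_ball_pos (hcov : ∀ x, ∃ i, x ∈ B i)
    (hball : ∀ i, ∀ x ∈ B i, B i ⊆ ball x r) :
    ∀ᵐ x ∂μ, 0 < (μ (ball x r)).toReal := by
  filter_upwards [ae_exists_mem_measure_ne_zero (μ := μ) hcov] with x hx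
  obtain ⟨i, hi, h0⟩ := hx
  exact ENNReal.toReal_pos (fun h => h0 (measure_mono_null (hball i x hi) h))
    (measure_ne_top _ _)

theorem ae_inv_measureReal_ball_le (hcov : ∀ x, ∃ i, x ∈ B i)
    (hball : ∀ i, ∀ x ∈ B i, B i ⊆ ball x r) :
    ∀ᵐ x ∂μ, ((μ (ball x r)).toReal)⁻¹ ≤
      ∑ i, (B i).indicator (fun _ => (μ.real (B i))⁻¹) x := by
  filter_upwards [ae_exists_mem_measure_ne_zero (μ := μ) hcov] with x hx
  obtain ⟨i, hi, h0⟩ := hx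
  have hpos : 0 < μ.real (B i) := ENNReal.toReal_pos h0 (measure_ne_top _ _)
  calc ((μ (ball x r)).toReal)⁻¹ ≤ (μ.real (B i))⁻¹ :=
        inv_anti₀ hpos (measureReal_mono (hball i x hi))
    _ = (B i).indicator (fun _ => (μ.real (B i))⁻¹) x := by
        rw [indicator_of_mem hi]
    _ ≤ _ := Finset.single_le_sum
        (f := fun j => (B j).indicator (fun _ => (μ.real (B j))⁻¹) x)
        (fun j _ => indicator_nonneg (fun _ _ => inv_nonneg.2 measureReal_nonneg) x)
        (Finset.mem_univ i)

variable [BorelSpace X] [SecondCountableTopology X]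

theorem measurable_measureReal_ball (μ : Measure X) [IsFiniteMeasure μ] (r : ℝ) :
    Measurable fun x => (μ (ball x r)).toReal := by
  have hopen : IsOpen {p : X × X | dist p.2 p.1 < r} :=
    isOpen_lt (continuous_snd.dist continuous_fst) continuous_const
  exact (measurable_measure_prodMk_left (ν := μ) hopen.measurableSet).ennreal_toReal

theorem integrable_inv_measureReal_ball (hB : ∀ i, MeasurableSet (B i))
    (hcov : ∀ x, ∃ i, x ∈ B i) (hball : ∀ i, ∀ x ∈ B i, B i ⊆ ball x r) :
    Integrable (fun x => ((μ (ball x r)).toReal)⁻¹) μ := by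
  have hint : Integrable (fun x => ∑ i, (B i).indicator (fun _ => (μ.real (B i))⁻¹) x) μ :=
    integrable_finsetSum _ fun i _ => (integrable_const _).indicator (hB i)
  refine hint.mono' (measurable_measureReal_ball μ r).inv.aestronglyMeasurable ?_
  filter_upwards [ae_inv_measureReal_ball_le (μ := μ) hcov hball] with x hx
  rwa [Real.norm_of_nonneg (inv_nonneg.2 ENNReal.toReal_nonneg)]

theorem integral_inv_measureReal_ball_le (hB : ∀ i, MeasurableSet (B i))
    (hcov : ∀ x, ∃ i, x ∈ B i) (hball : ∀ i, ∀ x ∈ B i, B i ⊆ ball x r) :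
    ∫ x, ((μ (ball x r)).toReal)⁻¹ ∂μ ≤ N := by
  have hi : ∀ i, Integrable ((B i).indicator (fun _ => (μ.real (B i))⁻¹)) μ :=
    fun i => (integrable_const _).indicator (hB i)
  calc ∫ x, ((μ (ball x r)).toReal)⁻¹ ∂μ
      ≤ ∫ x, ∑ i, (B i).indicator (fun _ => (μ.real (B i))⁻¹) x ∂μ :=
        integral_mono_ae (integrable_inv_measureReal_ball hB hcov hball)
          (integrable_finsetSum _ fun i _ => hi i) (ae_inv_measureReal_ball_le hcov hball)
    _ = ∑ i, μ.real (B i) * (μ.real (B i))⁻¹ := by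
        rw [integral_finsetSum _ fun i _ => hi i]
        exact Finset.sum_congr rfl fun i _ => by
          rw [integral_indicator_const _ (hB i), smul_eq_mul]
    _ ≤ ∑ _i : Fin N, (1 : ℝ) := Finset.sum_le_sum fun i _ => mul_inv_le_one
    _ = N := by simp

theorem integrable_rpow_measureReal_ball {q : ℝ} (hq : q ∈ Set.Ico (0 : ℝ) 1)
    (hB : ∀ i, MeasurableSet (B i))
    (hcov : ∀ x, ∃ i, x ∈ B i) (hball : ∀ i, ∀ x ∈ B i, B i ⊆ ball x r) :
    Integrable (fun x => (μ (ball x r)).toReal ^ (q - 1)) μ := by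
  refine (integrable_inv_measureReal_ball hB hcov hball).mono'
    ((measurable_measureReal_ball μ r).pow_const _).aestronglyMeasurable ?_
  filter_upwards [ae_measureReal_ball_pos (μ := μ) hcov hball] with x hx
  rw [Real.norm_of_nonneg (by positivity), ← Real.rpow_neg_one]
  exact Real.rpow_le_rpow_of_exponent_ge hx measureReal_le_one (by linarith [hq.1])

theorem Iq_le_rpow {q : ℝ} (hq : q ∈ Set.Ico (0 : ℝ) 1) (hB : ∀ i, MeasurableSet (B i))
    (hcov : ∀ x, ∃ i, x ∈ B i) (hball : ∀ i, ∀ x ∈ B i, B i ⊆ ball x r) :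
    Iq μ r q ≤ (N : ℝ) ^ (1 - q) := by
  have hq' : 0 ≤ 1 - q := by linarith [hq.2]
  have hpow : ∀ x, (μ (ball x r)).toReal ^ (q - 1) = ((μ (ball x r)).toReal)⁻¹ ^ (1 - q) := by
    intro x
    rw [Real.inv_rpow ENNReal.toReal_nonneg, ← Real.rpow_neg ENNReal.toReal_nonneg]
    ring_nf
  have hint := integrable_rpow_measureReal_ball (μ := μ) hq hB hcov hball
  rw [Iq, if_neg hq.2.ne]
  simp only [hpow] at hint ⊢
  calc ∫ x, ((μ (ball x r)).toReal)⁻¹ ^ (1 - q) ∂μ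
      ≤ (∫ x, ((μ (ball x r)).toReal)⁻¹ ∂μ) ^ (1 - q) :=
        (Real.concaveOn_rpow hq' (by linarith [hq.1])).le_map_integral
          (Real.continuous_rpow_const hq').continuousOn isClosed_Ici
          (Eventually.of_forall fun x => inv_nonneg.2 ENNReal.toReal_nonneg)
          (integrable_inv_measureReal_ball hB hcov hball) hint
    _ ≤ (N : ℝ) ^ (1 - q) := Real.rpow_le_rpow
        (integral_nonneg fun x => inv_nonneg.2 ENNReal.toReal_nonneg)
        (integral_inv_measureReal_ball_le hB hcov hball) hq'

theorem le_Iq_of_disjoint_balls {q : ℝ} (hq : q ∈ Set.Ico (0 : ℝ) 1)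
    (hB : ∀ i, MeasurableSet (B i))
    (hcov : ∀ x, ∃ i, x ∈ B i) (hball : ∀ i, ∀ x ∈ B i, B i ⊆ ball x r)
    {T : Finset X} {a b : ℝ} (hb : 0 ≤ b)
    (hT : (T : Set X).PairwiseDisjoint fun x => ball x r)
    (ha : ∀ x ∈ T, a ≤ μ.real (ball x r)) (hb' : ∀ x ∈ T, μ.real (closedBall x (2 * r)) ≤ b) :
    T.card * (a * b ^ (q - 1)) ≤ Iq μ r q := by
  have hint := integrable_rpow_measureReal_ball (μ := μ) hq hB hcov hball
  have hlow : ∀ x ∈ T, a * b ^ (q - 1) ≤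
      ∫ y in ball x r, (μ (ball y r)).toReal ^ (q - 1) ∂μ := by
    intro x hx
    calc a * b ^ (q - 1) ≤ μ.real (ball x r) * b ^ (q - 1) :=
          mul_le_mul_of_nonneg_right (ha x hx) (by positivity)
      _ = ∫ _ in ball x r, b ^ (q - 1) ∂μ := by rw [setIntegral_const, smul_eq_mul]
      _ ≤ _ := by
          refine setIntegral_mono_on_ae (integrable_const _).integrableOn hint.integrableOn
            measurableSet_ball ?_
          filter_upwards [ae_measureReal_ball_pos (μ := μ) hcov hball] with y hy hyx
          have hsub : ball y r ⊆ closedBall x (2 * r) := by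
            intro z hz
            rw [mem_ball] at hz hyx
            rw [mem_closedBall]
            linarith [dist_triangle z y x]
          exact Real.rpow_le_rpow_of_nonpos hy
            ((measureReal_mono hsub).trans (hb' x hx)) (by linarith [hq.2])
  rw [Iq, if_neg hq.2.ne]
  calc (T.card : ℝ) * (a * b ^ (q - 1)) = ∑ _x ∈ T, a * b ^ (q - 1) := by simp
    _ ≤ ∑ x ∈ T, ∫ y in ball x r, (μ (ball y r)).toReal ^ (q - 1) ∂μ :=
        Finset.sum_le_sum hlow
    _ = ∫ y in ⋃ x ∈ T, ball x r, (μ (ball y r)).toReal ^ (q - 1) ∂μ :=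
        (integral_biUnion_finset T (fun _ _ => measurableSet_ball) hT
          fun _ _ => hint.integrableOn).symm
    _ ≤ _ := setIntegral_le_integral hint (Eventually.of_forall fun _ => by positivity)

end BallPowers

theorem Dq_eq_div {X : Type*} [MetricSpace X] [MeasurableSpace X] (μ : Measure X) {r q : ℝ}
    (hq : q < 1) : Dq μ r q = Real.log (Iq μ r q) / ((1 - q) * -Real.log r) := by
  have h : (1 - q) * -Real.log r = (q - 1) * Real.log r := by ring
  rw [Dq, if_neg hq.ne, h, div_mul_div_comm, one_mul]

section Covers

variable {X : Type*} [MetricSpace X] {K : Set X}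

theorem IsCompact.exists_cover_coveringNumber (hK : IsCompact K) {r : ℝ} (hr : 0 < r) :
    ∃ c : Fin (coveringNumber K r) → X, K ⊆ ⋃ i, ball (c i) r := by
  refine Nat.sInf_mem (s := {n : ℕ | ∃ c : Fin n → X, K ⊆ ⋃ i, ball (c i) r}) ?_
  obtain ⟨t, -, htf, ht⟩ := hK.finite_cover_balls hr
  refine ⟨htf.toFinset.card, fun i => (htf.toFinset.equivFin.symm i : X), fun x hx => ?_⟩
  obtain ⟨y, hy, hxy⟩ := mem_iUnion₂.1 (ht hx)
  exact mem_iUnion.2 ⟨htf.toFinset.equivFin ⟨y, htf.mem_toFinset.2 hy⟩, by simpa using hxy⟩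

/-- A compact set is covered, in its own right, by `coveringNumber K (r / 2)` measurable cells,
each of which lies in the `r`-ball around any of its points. -/
theorem IsCompact.exists_cells [MeasurableSpace X] [BorelSpace X] (hK : IsCompact K) {r : ℝ}
    (hr : 0 < r) :
    ∃ B : Fin (coveringNumber K (r / 2)) → Set K, (∀ i, MeasurableSet (B i)) ∧
      (∀ x, ∃ i, x ∈ B i) ∧ ∀ i, ∀ x ∈ B i, B i ⊆ ball x r := by
  obtain ⟨c, hc⟩ := hK.exists_cover_coveringNumber (half_pos hr)
  refine ⟨fun i => Subtype.val ⁻¹' ball (c i) (r / 2),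
    fun i => measurable_subtype_coe measurableSet_ball, fun x => ?_, fun i x hx y hy => ?_⟩
  · obtain ⟨i, hi⟩ := mem_iUnion.1 (hc x.2)
    exact ⟨i, hi⟩
  · rw [mem_preimage, mem_ball] at hx hy
    rw [mem_ball, Subtype.dist_eq]
    linarith [dist_triangle_right (y : X) x (c i)]

theorem exists_separated_finset (K : Set X) {r : ℝ} (hr : 0 < r) :
    ∃ S : Finset K, S.card = coveringNumber K r ∧
      (S : Set K).Pairwise fun x y => r ≤ dist x y := by
  classical
  have key : ∀ k ≤ coveringNumber K r, ∃ S : Finset K, S.card = k ∧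
      (S : Set K).Pairwise fun x y => r ≤ dist x y := by
    intro k
    induction k with
    | zero => exact fun _ => ⟨∅, by simp⟩
    | succ k ih =>
      intro hk
      obtain ⟨S, hS, hsep⟩ := ih (by omega)
      have hnot : ¬ ∃ c : Fin k → X, K ⊆ ⋃ i, ball (c i) r :=
        Nat.notMem_of_lt_sInf (s := {n : ℕ | ∃ c : Fin n → X, K ⊆ ⋃ i, ball (c i) r}) hk
      have hx : ∃ x : K, ∀ y ∈ S, r ≤ dist x y := by
        by_contra! hcon
        refine hnot ⟨fun i => ((S.equivFinOfCardEq hS).symm i : K), fun x hx => ?_⟩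
        obtain ⟨y, hy, hxy⟩ := hcon ⟨x, hx⟩
        refine mem_iUnion.2 ⟨S.equivFinOfCardEq hS ⟨y, hy⟩, ?_⟩
        rw [Subtype.dist_eq] at hxy
        simpa using hxy
      obtain ⟨x, hx⟩ := hx
      have hxS : x ∉ S := fun h => hr.not_ge (by simpa using hx x h)
      refine ⟨insert x S, by rw [Finset.card_insert_of_notMem hxS, hS], ?_⟩
      rw [Finset.coe_insert, pairwise_insert]
      exact ⟨hsep, fun y hy _ => ⟨hx y hy, by rw [dist_comm]; exact hx y hy⟩⟩
  exact key _ le_rfl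

end Covers

theorem Dq_le_log_coveringNumber {X : Type*} [MetricSpace X] [MeasurableSpace X] [BorelSpace X]
    {K : Set X} [SecondCountableTopology K] (hK : IsCompact K) (μ : ProbabilityMeasure K)
    {r q : ℝ} (hr : 0 < r) (hr1 : r < 1) (hq : q ∈ Set.Ico (0 : ℝ) 1) :
    Dq (μ : Measure K) r q ≤ Real.log (coveringNumber K (r / 2)) / -Real.log r := by
  obtain ⟨B, hB, hcov, hball⟩ := hK.exists_cells hr
  have hI := Iq_le_rpow (μ := (μ : Measure K)) hq hB hcov hball
  have hq1 : 0 < 1 - q := by linarith [hq.2]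
  have hlog : 0 < -Real.log r := neg_pos.2 (Real.log_neg hr hr1)
  have hI0 : 0 ≤ Iq (μ : Measure K) r q := by
    rw [Iq, if_neg hq.2.ne]
    exact integral_nonneg fun _ => by positivity
  have hlogI : Real.log (Iq (μ : Measure K) r q) ≤
      (1 - q) * Real.log (coveringNumber K (r / 2)) := by
    rcases hI0.eq_or_lt with h0 | h0
    · rw [← h0, Real.log_zero]
      exact mul_nonneg hq1.le (Real.log_natCast_nonneg _)
    · rcases Nat.eq_zero_or_pos (coveringNumber K (r / 2)) with hN | hN
      · rw [hN, Nat.cast_zero, Real.zero_rpow hq1.ne'] at hI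
        exact absurd hI h0.not_ge
      · rw [← Real.log_rpow (by exact_mod_cast hN)]
        exact Real.log_le_log h0 hI
  rw [Dq_eq_div _ hq.2, ← mul_div_mul_left (Real.log (coveringNumber K (r / 2))) _ hq1.ne']
  gcongr

theorem tendsto_neg_log_nhdsGT_zero : Tendsto (fun r : ℝ => -Real.log r) (𝓝[>] 0) atTop :=
  tendsto_neg_atBot_atTop.comp Real.tendsto_log_nhdsGT_zero

theorem tendsto_mul_const_nhdsGT_zero {a : ℝ} (ha : 0 < a) :
    Tendsto (fun r : ℝ => r * a) (𝓝[>] 0) (𝓝[>] 0) := by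
  refine tendsto_nhdsWithin_of_tendsto_nhds_of_eventually_within _ ?_ ?_
  · have h : Tendsto (fun r : ℝ => r * a) (𝓝 0) (𝓝 (0 * a)) :=
      (continuous_mul_const a).tendsto 0
    rw [zero_mul] at h
    exact h.mono_left nhdsWithin_le_nhds
  · filter_upwards [self_mem_nhdsWithin] with r hr using mul_pos hr ha

theorem upperDim_le_upperBoxDim {X : Type*} [MetricSpace X] [MeasurableSpace X] [BorelSpace X]
    {K : Set X} [SecondCountableTopology K] (hK : IsCompact K) (μ : ProbabilityMeasure K)
    {q : ℝ} (hq : q ∈ Set.Ico (0 : ℝ) 1) : upperDim (μ : Measure K) q ≤ upperBoxDim K := by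
  refine le_of_forall_gt fun b hb => ?_
  obtain ⟨c', hc', hc'b⟩ := EReal.lt_iff_exists_real_btwn.1 hb
  obtain ⟨c, hc, hcc'⟩ := EReal.lt_iff_exists_real_btwn.1 hc'
  refine lt_of_le_of_lt ?_ hc'b
  have hcc : c < c' := by exact_mod_cast hcc'
  have hev := (tendsto_mul_const_nhdsGT_zero (a := 1 / 2) (by norm_num)).eventually
    (eventually_lt_of_limsup_lt hc)
  refine limsup_le_of_le (by isBoundedDefault) ?_
  filter_upwards [hev, Ioo_mem_nhdsGT (zero_lt_one' ℝ),
    tendsto_neg_log_nhdsGT_zero.eventually_ge_atTop (c * Real.log 2 / (c' - c))]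
    with r h ⟨hr0, hr1⟩ hlarge
  have hlog : 0 < -Real.log r := neg_pos.2 (Real.log_neg hr0 hr1)
  have hlog2 : 0 < Real.log 2 := Real.log_pos one_lt_two
  have hhalf : Real.log (r / 2) = Real.log r - Real.log 2 :=
    Real.log_div hr0.ne' two_ne_zero
  rw [mul_one_div, EReal.coe_lt_coe_iff, hhalf, div_lt_iff₀ (by linarith)] at h
  rw [div_le_iff₀ (by linarith)] at hlarge
  rw [EReal.coe_le_coe_iff]
  refine (Dq_le_log_coveringNumber hK μ hr0 hr1 hq).trans ?_
  rw [div_le_iff₀ hlog]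
  nlinarith

section Mixture

variable {X : Type*} [MeasurableSpace X]

/-- The convex combination `(1 - ε) ν + ε ξ` of probability measures. -/
def mixture (ν ξ : ProbabilityMeasure X) (ε : unitInterval) : ProbabilityMeasure X :=
  ⟨ENNReal.ofReal (1 - ε) • (ν : Measure X) + ENNReal.ofReal ε • (ξ : Measure X), ⟨by
    simp [← ENNReal.ofReal_add (sub_nonneg.2 ε.2.2) ε.2.1]⟩⟩

theorem mixture_real_apply (ν ξ : ProbabilityMeasure X) (ε : unitInterval) (A : Set X) :
    (mixture ν ξ ε : Measure X).real A =
      (1 - ε) * (ν : Measure X).real A + ε * (ξ : Measure X).real A := by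
  have h1 : (0 : ℝ) ≤ 1 - ε := sub_nonneg.2 ε.2.2
  have h0 : (0 : ℝ) ≤ ε := ε.2.1
  have hfin : ∀ (t : ℝ) (ρ : ProbabilityMeasure X),
      (ENNReal.ofReal t • (ρ : Measure X)) A ≠ ⊤ := fun t ρ => by
    rw [Measure.smul_apply, smul_eq_mul]
    finiteness
  simp only [mixture, ProbabilityMeasure.coe_mk]
  rw [measureReal_add_apply (hfin _ ν) (hfin _ ξ), measureReal_ennreal_smul_apply, measureReal_ennreal_smul_apply,
    ENNReal.toReal_ofReal h1, ENNReal.toReal_ofReal h0]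

theorem tendsto_mixture [TopologicalSpace X] [OpensMeasurableSpace X]
    (ν : ProbabilityMeasure X) (ξ : ℕ → ProbabilityMeasure X) {ε : ℕ → unitInterval}
    (hε : Tendsto (fun k => (ε k : ℝ)) atTop (𝓝 0)) :
    Tendsto (fun k => mixture ν (ξ k) (ε k)) atTop (𝓝 ν) := by
  rw [ProbabilityMeasure.tendsto_iff_forall_integral_tendsto]
  intro f
  have hfint : ∀ ρ : ProbabilityMeasure X, Integrable f (ρ : Measure X) :=
    fun ρ => f.integrable _
  have heq : ∀ k, ∫ x, f x ∂(mixture ν (ξ k) (ε k) : Measure X) =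
      (1 - ε k) * ∫ x, f x ∂(ν : Measure X) + ε k * ∫ x, f x ∂(ξ k : Measure X) := by
    intro k
    have h1 : (0 : ℝ) ≤ 1 - ε k := sub_nonneg.2 (ε k).2.2
    have h0 : (0 : ℝ) ≤ ε k := (ε k).2.1
    simp only [mixture, ProbabilityMeasure.coe_mk]
    rw [integral_add_measure ((hfint ν).smul_measure ENNReal.ofReal_ne_top)
      ((hfint (ξ k)).smul_measure ENNReal.ofReal_ne_top), integral_smul_measure,
      integral_smul_measure, ENNReal.toReal_ofReal h1, ENNReal.toReal_ofReal h0,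
      smul_eq_mul, smul_eq_mul]
  simp only [heq]
  have hbdd : Tendsto (fun k => (ε k : ℝ) * ∫ x, f x ∂(ξ k : Measure X)) atTop (𝓝 0) := by
    refine squeeze_zero_norm (a := fun k => (ε k : ℝ) * ‖f‖) (fun k => ?_)
      (by simpa using hε.mul_const ‖f‖)
    rw [norm_mul, Real.norm_of_nonneg (ε k).2.1]
    exact mul_le_mul_of_nonneg_left (f.norm_integral_le_norm _) (ε k).2.1
  have hone : Tendsto (fun k => 1 - (ε k : ℝ)) atTop (𝓝 (1 - 0)) := tendsto_const_nhds.sub hε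
  simpa using (hone.mul_const (∫ x, f x ∂(ν : Measure X))).add hbdd

/-- The normalized counting measure on a nonempty finite set. -/
def uniformFinset (S : Finset X) (hS : S.Nonempty) : ProbabilityMeasure X :=
  ⟨(S.card : ENNReal)⁻¹ • ∑ x ∈ S, Measure.dirac x, ⟨by
    have h0 : (S.card : ENNReal) ≠ 0 := by simpa using hS.ne_empty
    simpa using ENNReal.inv_mul_cancel h0 (ENNReal.natCast_ne_top _)⟩⟩

theorem uniformFinset_real_apply {S : Finset X} (hS : S.Nonempty) {A : Set X}
    (hA : MeasurableSet A) :
    (uniformFinset S hS : Measure X).real A = (S.card : ℝ)⁻¹ * ∑ x ∈ S, A.indicator 1 x := by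
  have hsum : (∑ x ∈ S, Measure.dirac x).real A = ∑ x ∈ S, A.indicator (1 : X → ℝ) x := by
    rw [measureReal_def, Measure.finsetSum_apply,
      ENNReal.toReal_sum fun x _ => measure_ne_top _ _]
    refine Finset.sum_congr rfl fun x _ => ?_
    rw [Measure.dirac_apply' x hA]
    by_cases hx : x ∈ A <;> simp [hx]
  simp only [uniformFinset, ProbabilityMeasure.coe_mk]
  rw [measureReal_ennreal_smul_apply, hsum, ENNReal.toReal_inv, ENNReal.toReal_natCast]

theorem inv_card_le_uniformFinset_real {S : Finset X} (hS : S.Nonempty) {x : X} (hx : x ∈ S)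
    {A : Set X} (hA : MeasurableSet A) (hxA : x ∈ A) :
    (S.card : ℝ)⁻¹ ≤ (uniformFinset S hS : Measure X).real A := by
  rw [uniformFinset_real_apply hS hA]
  refine le_mul_of_one_le_right (by positivity) ?_
  calc (1 : ℝ) = A.indicator 1 x := by simp [hxA]
    _ ≤ _ := Finset.single_le_sum (f := A.indicator (1 : X → ℝ))
      (fun y _ => indicator_nonneg (fun _ _ => zero_le_one) y) hx

theorem uniformFinset_real_le {S : Finset X} (hS : S.Nonempty) {x : X} (hx : x ∈ S)
    {A : Set X} (hA : MeasurableSet A) (hxA : ∀ y ∈ S, y ∈ A → y = x) :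
    (uniformFinset S hS : Measure X).real A ≤ (S.card : ℝ)⁻¹ := by
  rw [uniformFinset_real_apply hS hA]
  refine mul_le_of_le_one_right (by positivity) ?_
  rw [Finset.sum_eq_single_of_mem x hx fun y hy hyx =>
    indicator_of_notMem (fun h => hyx (hxA y hy h)) _]
  by_cases h : x ∈ A <;> simp [h]

end Mixture

section Semicontinuity

variable {X : Type*} [TopologicalSpace X] [HasOuterApproxClosed X] [MeasurableSpace X]
  [OpensMeasurableSpace X]

theorem IsOpen.isOpen_setOf_lt_measureReal {U : Set X} (hU : IsOpen U) {a : ℝ} (ha : 0 ≤ a) :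
    IsOpen {μ : ProbabilityMeasure X | a < (μ : Measure X).real U} := by
  refine isOpen_iff_eventually.2 fun μ (hμ : a < (μ : Measure X).real U) => ?_
  have hlt := ((ENNReal.ofReal_lt_iff_lt_toReal ha (measure_ne_top _ _)).2 hμ).trans_le
    (ProbabilityMeasure.le_liminf_measure_open_of_tendsto (tendsto_id (x := 𝓝 μ)) hU)
  filter_upwards [eventually_lt_of_lt_liminf hlt] with ρ hρ
  exact (ENNReal.ofReal_lt_iff_lt_toReal ha (measure_ne_top _ _)).1 hρ

theorem IsClosed.isOpen_setOf_measureReal_lt {F : Set X} (hF : IsClosed F) (b : ℝ) :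
    IsOpen {μ : ProbabilityMeasure X | (μ : Measure X).real F < b} := by
  refine isOpen_iff_eventually.2 fun μ (hμ : (μ : Measure X).real F < b) => ?_
  have hlt := (ProbabilityMeasure.limsup_measure_closed_le_of_tendsto
    (tendsto_id (x := 𝓝 μ)) hF).trans_lt
    ((ENNReal.lt_ofReal_iff_toReal_lt (measure_ne_top _ _)).2 hμ)
  filter_upwards [eventually_lt_of_limsup_lt hlt] with ρ hρ
  exact (ENNReal.lt_ofReal_iff_toReal_lt (measure_ne_top _ _)).1 hρ

end Semicontinuity

/-- Among `N` points with disjoint surrounding sets, at least half carry mass at most `2 / N`. -/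
theorem card_le_two_mul_card_filter {X : Type*} [MeasurableSpace X] (ν : Measure X)
    [IsProbabilityMeasure ν] (S : Finset X) {A : X → Set X} (hA : ∀ x, MeasurableSet (A x))
    (hdisj : (S : Set X).PairwiseDisjoint A) :
    (S.card : ℝ) ≤ 2 * ({x ∈ S | ν.real (A x) ≤ 2 / S.card} : Finset X).card := by
  rcases S.eq_empty_or_nonempty with rfl | hS
  · simp
  have hN : (0 : ℝ) < S.card := by exact_mod_cast hS.card_pos
  have hsplit := Finset.card_filter_add_card_filter_not (s := S)
    (fun x => ν.real (A x) ≤ 2 / S.card)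
  have hbad : (({x ∈ S | ¬ ν.real (A x) ≤ 2 / S.card} : Finset X).card : ℝ) * (2 / S.card) ≤ 1 :=
    calc _ = ∑ _x ∈ S with ¬ ν.real (A _x) ≤ 2 / S.card, (2 / S.card : ℝ) := by simp
      _ ≤ ∑ x ∈ S with ¬ ν.real (A x) ≤ 2 / S.card, ν.real (A x) :=
          Finset.sum_le_sum fun x hx => (not_le.1 (Finset.mem_filter.1 hx).2).le
      _ ≤ ∑ x ∈ S, ν.real (A x) := Finset.sum_le_sum_of_subset_of_nonneg
          (Finset.filter_subset _ _) fun _ _ _ => measureReal_nonneg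
      _ = ν.real (⋃ x ∈ S, A x) := (measureReal_biUnion_finset hdisj fun x _ => hA x).symm
      _ ≤ 1 := measureReal_le_one
  rw [mul_div_assoc', div_le_one hN] at hbad
  have : (S.card : ℝ) = ({x ∈ S | ν.real (A x) ≤ 2 / S.card} : Finset X).card +
      ({x ∈ S | ¬ ν.real (A x) ≤ 2 / S.card} : Finset X).card := by exact_mod_cast hsplit.symm
  linarith

/-- Measures whose dimension quotients at some small scale are bounded below by nearly `c`. -/
def largeDimSet {X : Type*} [MetricSpace X] [MeasurableSpace X] (c η : ℝ) :
    Set (ProbabilityMeasure X) :=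
  {μ | ∃ r ∈ Set.Ioo 0 η, ∀ q ∈ Set.Ico (0 : ℝ) 1, c - η / (1 - q) ≤ Dq (μ : Measure X) r q}

theorem le_upperDim_of_mem_largeDimSet {X : Type*} [MetricSpace X] [MeasurableSpace X]
    {μ : ProbabilityMeasure X} {c q : ℝ} (hq : q ∈ Set.Ico (0 : ℝ) 1)
    (h : ∀ n : ℕ, μ ∈ largeDimSet c (1 / ((n : ℝ) + 1))) :
    (c : EReal) ≤ upperDim (μ : Measure X) q := by
  have hq1 : 0 < 1 - q := by linarith [hq.2]
  refine le_of_forall_lt fun b hb => ?_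
  obtain ⟨c', hbc', hc'⟩ := EReal.lt_iff_exists_real_btwn.1 hb
  refine hbc'.trans_le (le_limsup_of_frequently_le ?_ (by isBoundedDefault))
  have hcc : 0 < c - c' := sub_pos.2 (by exact_mod_cast hc')
  rw [(nhdsGT_basis (0 : ℝ)).frequently_iff]
  intro δ hδ
  obtain ⟨n, hn⟩ := exists_nat_one_div_lt (lt_min hδ (mul_pos hcc hq1))
  obtain ⟨r, hr, hD⟩ := h n
  refine ⟨r, ⟨hr.1, hr.2.trans (hn.trans_le (min_le_left _ _))⟩, ?_⟩
  have hle := (div_lt_iff₀ hq1).2 (hn.trans_le (min_le_right _ _))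
  rw [EReal.coe_le_coe_iff]
  linarith [hD q hq]

theorem sub_div_le_Dq {X : Type*} [MetricSpace X] [MeasurableSpace X] {μ : Measure X}
    {r q c η δ N : ℝ} (hr : 0 < r) (hr1 : r < 1) (hq : q ∈ Set.Ico (0 : ℝ) 1) (hN : 0 < N)
    (hδ : 0 < δ) (hcN : c < Real.log N / -Real.log (r * 5)) (hr5 : r * 5 < 1)
    (hsmall : |c| * Real.log 5 - Real.log δ ≤ η * -Real.log r)
    (hI : δ * N ^ (1 - q) ≤ Iq μ r q) : c - η / (1 - q) ≤ Dq μ r q := by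
  have hq1 : 0 < 1 - q := by linarith [hq.2]
  have hlog : 0 < -Real.log r := neg_pos.2 (Real.log_neg hr hr1)
  have hlog5 : 0 < Real.log 5 := Real.log_pos (by norm_num)
  have hlogr5 : 0 < -Real.log (r * 5) := neg_pos.2 (Real.log_neg (by linarith) hr5)
  have hpow : 0 < N ^ (1 - q) := Real.rpow_pos_of_pos hN _
  have hlogI := Real.log_le_log (mul_pos hδ hpow) hI
  rw [Real.log_mul hδ.ne' hpow.ne', Real.log_rpow hN] at hlogI
  rw [lt_div_iff₀ hlogr5, Real.log_mul hr.ne' (by norm_num)] at hcN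
  have habs : (1 - q) * (c * Real.log 5) ≤ |c| * Real.log 5 := by
    have h1 : c * Real.log 5 ≤ |c| * Real.log 5 :=
      mul_le_mul_of_nonneg_right (le_abs_self c) hlog5.le
    have h2 : 0 ≤ q * (|c| * Real.log 5) := mul_nonneg hq.1 (by positivity)
    nlinarith
  have hscaled := mul_le_mul_of_nonneg_left hcN.le hq1.le
  rw [Dq_eq_div _ hq.2, le_div_iff₀ (mul_pos hq1 hlog)]
  have hexp : (c - η / (1 - q)) * ((1 - q) * -Real.log r) =
      (1 - q) * (c * -Real.log r) - η * -Real.log r := by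
    field_simp
    ring
  rw [hexp]
  nlinarith

theorem le_half_card_mul_rpow {N t ε q : ℝ} (hN : 0 < N) (hε : 0 < ε)
    (hq : q ∈ Set.Ico (0 : ℝ) 1) (ht : N ≤ 2 * t) :
    ε / 16 * N ^ (1 - q) ≤ t * (ε / (2 * N) * (4 / N) ^ (q - 1)) := by
  have h4 : (4 : ℝ)⁻¹ ≤ 4 ^ (q - 1) := by
    rw [← Real.rpow_neg_one]
    exact Real.rpow_le_rpow_of_exponent_le (by norm_num) (by linarith [hq.1])
  have hdiv : (4 / N) ^ (q - 1) = 4 ^ (q - 1) * N ^ (1 - q) := by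
    rw [Real.div_rpow (by norm_num) hN.le, div_eq_mul_inv, ← Real.rpow_neg hN.le, neg_sub]
  have hpow : 0 < N ^ (1 - q) := Real.rpow_pos_of_pos hN _
  rw [hdiv]
  calc ε / 16 * N ^ (1 - q) = N / 2 * (ε / (2 * N) * (4⁻¹ * N ^ (1 - q))) := by
        field_simp; norm_num
    _ ≤ t * (ε / (2 * N) * (4 ^ (q - 1) * N ^ (1 - q))) := by
        have ht' : N / 2 ≤ t := by linarith
        have ht0 : 0 ≤ t := by linarith
        gcongr

theorem exists_mixture_mem_interior {X : Type*} [MetricSpace X] [MeasurableSpace X]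
    [BorelSpace X] {K : Set X} [SecondCountableTopology K] (hK : IsCompact K)
    (hKne : K.Nonempty) {c η : ℝ} (hη : 0 < η)
    (hc : (c : EReal) < upperBoxDim K) (ν : ProbabilityMeasure K) {ε : unitInterval}
    (hε : 0 < (ε : ℝ)) :
    ∃ ξ : ProbabilityMeasure K, mixture ν ξ ε ∈ interior (largeDimSet c η) := by
  have hfreq := frequently_lt_of_lt_limsup (by isBoundedDefault) hc
  have hdiv := tendsto_mul_const_nhdsGT_zero (a := 1 / 5) (by norm_num)
  have hev := (hdiv.eventually (Ioo_mem_nhdsGT hη)).and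
    ((hdiv.eventually (tendsto_neg_log_nhdsGT_zero.eventually_ge_atTop
      ((|c| * Real.log 5 - Real.log (ε / 16)) / η))).and (Ioo_mem_nhdsGT (zero_lt_one' ℝ)))
  obtain ⟨ρ, hρc, ⟨hr0, hrη⟩, hsmall, hρ0, hρ1⟩ := (hfreq.and_eventually hev).exists
  obtain ⟨r, rfl⟩ : ∃ r, ρ = r * 5 := ⟨ρ / 5, by ring⟩
  have hr : r * 5 * (1 / 5) = r := by ring
  simp only [hr] at hr0 hrη hsmall
  rw [div_le_iff₀' hη] at hsmall
  rw [EReal.coe_lt_coe_iff] at hρc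
  obtain ⟨S, hScard, hsep⟩ := exists_separated_finset K hρ0
  have hNpos : 0 < coveringNumber K (r * 5) := by
    obtain ⟨b, hb⟩ := hK.exists_cover_coveringNumber hρ0
    obtain ⟨x, hx⟩ := hKne
    obtain ⟨i, -⟩ := mem_iUnion.1 (hb hx)
    exact i.pos
  rw [← hScard] at hρc hNpos
  have hSne : S.Nonempty := Finset.card_pos.1 hNpos
  have hN : (0 : ℝ) < S.card := by exact_mod_cast hNpos
  have hdisj : (S : Set K).PairwiseDisjoint fun x => closedBall x (2 * r) := by
    intro x hx y hy hxy
    exact closedBall_disjoint_closedBall (by linarith [hsep hx hy hxy])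
  set T : Finset K := {x ∈ S | (ν : Measure K).real (closedBall x (2 * r)) ≤ 2 / S.card}
  have hTS : T ⊆ S := Finset.filter_subset _ _
  have hT : (S.card : ℝ) ≤ 2 * T.card :=
    card_le_two_mul_card_filter (ν : Measure K) S (fun _ => measurableSet_closedBall) hdisj
  refine ⟨uniformFinset S hSne, mem_interior.2
    ⟨⋂ x ∈ T,
      {μ : ProbabilityMeasure K | (ε : ℝ) / (2 * S.card) < (μ : Measure K).real (ball x r)} ∩
      {μ : ProbabilityMeasure K | (μ : Measure K).real (closedBall x (2 * r)) < 4 / S.card},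
      fun μ hμ => ?_, ?_, ?_⟩⟩
  · simp only [mem_iInter, mem_inter_iff, mem_ofPred_eq] at hμ
    refine ⟨r, ⟨hr0, hrη⟩, fun q hq => ?_⟩
    obtain ⟨B, hB, hcov, hball⟩ := hK.exists_cells hr0
    have hI := le_Iq_of_disjoint_balls (μ := (μ : Measure K)) hq hB hcov hball
      (T := T) (a := (ε : ℝ) / (2 * S.card)) (b := 4 / S.card) (by positivity)
      (fun x hx y hy hxy => (hdisj (hTS hx) (hTS hy) hxy).mono
        (ball_subset_closedBall.trans (closedBall_subset_closedBall (by linarith)))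
        (ball_subset_closedBall.trans (closedBall_subset_closedBall (by linarith))))
      (fun x hx => (hμ x hx).1.le) (fun x hx => (hμ x hx).2.le)
    exact sub_div_le_Dq hr0 (by linarith) hq hN (by positivity) hρc hρ1 hsmall
      ((le_half_card_mul_rpow hN hε hq hT).trans hI)
  · exact T.finite_toSet.isOpen_biInter fun x _ =>
      (isOpen_ball.isOpen_setOf_lt_measureReal (by positivity)).inter
        (isClosed_closedBall.isOpen_setOf_measureReal_lt _)
  · simp only [mem_iInter, mem_inter_iff, mem_ofPred_eq, mixture_real_apply]
    intro x hx
    have hxS := hTS hx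
    have hlow := inv_card_le_uniformFinset_real hSne hxS measurableSet_ball
      (mem_ball_self hr0)
    have hup := uniformFinset_real_le hSne hxS (A := closedBall x (2 * r))
      measurableSet_closedBall fun y hy hyx => by
        by_contra hne
        linarith [hsep hy hxS hne, mem_closedBall.1 hyx]
    have hν := (Finset.mem_filter.1 hx).2
    have hε1 : (0 : ℝ) ≤ 1 - ε := sub_nonneg.2 ε.2.2
    have hinv : (0 : ℝ) < (S.card : ℝ)⁻¹ := inv_pos.2 hN
    constructor
    · calc (ε : ℝ) / (2 * S.card) = ε * (S.card : ℝ)⁻¹ / 2 := by field_simp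
        _ < ε * (S.card : ℝ)⁻¹ := half_lt_self (mul_pos hε hinv)
        _ ≤ ε * (uniformFinset S hSne : Measure K).real (ball x r) := by gcongr
        _ ≤ _ := le_add_of_nonneg_left (mul_nonneg hε1 measureReal_nonneg)
    · calc _ ≤ 1 * (2 / (S.card : ℝ)) + 1 * (S.card : ℝ)⁻¹ := by
            gcongr
            · linarith
            · exact ε.2.2
        _ = 3 * (S.card : ℝ)⁻¹ := by ring
        _ < 4 * (S.card : ℝ)⁻¹ := by gcongr; norm_num
        _ = 4 / S.card := by ring

theorem dense_interior_largeDimSet {X : Type*} [MetricSpace X] [MeasurableSpace X]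
    [BorelSpace X] {K : Set X} [SecondCountableTopology K] (hK : IsCompact K)
    (hKne : K.Nonempty) {c η : ℝ} (hη : 0 < η) (hc : (c : EReal) < upperBoxDim K) :
    Dense (interior (largeDimSet (X := K) c η)) := by
  intro ν
  let ε : ℕ → unitInterval := fun k => ⟨1 / ((k : ℝ) + 1), by positivity, by
    rw [div_le_one (by positivity)]
    linarith [(k.cast_nonneg : (0 : ℝ) ≤ k)]⟩
  have hε : ∀ k, 0 < (ε k : ℝ) := fun k => Nat.one_div_pos_of_nat
  choose ξ hξ using fun k => exists_mixture_mem_interior hK hKne hη hc ν (hε k)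
  exact mem_closure_of_tendsto (tendsto_mixture ν ξ tendsto_one_div_add_atTop_nhds_zero_nat)
    (Eventually.of_forall hξ)

/-- A typical measure on an infinite compact `K ⊆ ℝ^d` has upper `L^q`-dimension equal to the
upper box dimension of `K`, simultaneously for all `q ∈ [0,1)`. -/
theorem typical_upperDim_eq_upperBox (d : ℕ) (K : Set (Euc d))
    (hK : IsCompact K) (hKinf : K.Infinite) :
    ∃ G : Set (ProbabilityMeasure ↥K),
      G ⊆ {μ : ProbabilityMeasure ↥K |
        ∀ q : ℝ, q ∈ Set.Ico (0:ℝ) 1 → upperDim (μ : Measure ↥K) q = upperBoxDim K} ∧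
      Dense G ∧ IsGδ G := by
  have : CompactSpace K := isCompact_iff_compactSpace.1 hK
  refine ⟨⋂ (c : ℚ) (_ : ((c : ℝ) : EReal) < upperBoxDim K) (n : ℕ),
    interior (largeDimSet (c : ℝ) (1 / ((n : ℝ) + 1))), fun μ hμ q hq => ?_, ?_, ?_⟩
  · simp only [mem_iInter] at hμ
    refine le_antisymm (upperDim_le_upperBoxDim hK μ hq) (le_of_forall_lt fun b hb => ?_)
    obtain ⟨c, hbc, hc⟩ := EReal.lt_iff_exists_rat_btwn.1 hb
    exact hbc.trans_le
      (le_upperDim_of_mem_largeDimSet hq fun n => interior_subset (hμ c hc n))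
  · exact dense_iInter_of_Gδ
      (fun c => .iInter fun _ => .iInter fun n => isOpen_interior.isGδ)
      fun c => dense_iInter_of_Gδ (fun _ => .iInter fun n => isOpen_interior.isGδ)
        fun hc => dense_iInter_of_isOpen (fun n => isOpen_interior)
          fun n => dense_interior_largeDimSet hK hKinf.nonempty Nat.one_div_pos_of_nat hc
  · exact .iInter fun c => .iInter fun _ => .iInter fun n => isOpen_interior.isGδ

end
end
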